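/- arXiv:1706.05607 — 2 statements merged into one kernel-verified Lean document; each statement's English description precedes it below -/
import Mathlib

section
/- Let S be the string rewriting system constructed from a given GPCP instance as described. Suppose i_1, …, i_k ∈ {1, …, n} is a solution of the GPCP instance, and let w = x_0 x_{i_1} ⋯ x_{i_k} x_{n+1} (= y_0 y_{i_1} ⋯ y_{i_k} y_{n+1}) be the matched string. Set W = h_1(w) · c_{n+1} B c_{i_k} B c_{i_{k-1}} B ⋯ B c_{i_1} B c_0. Then ¢_1 W →*_S λ and ¢_2 W →*_S λ; in particular ¢_1 W ↔*_S ¢_2 W. -/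
/-- The two-letter alphabet Γ = {a, b} of the GPCP instance. -/
inductive Γ : Type where
  | a : Γ
  | b : Γ

/-- The alphabet Σ̂ = {a₁,a₂,a₃,b₁,b₂,b₃,¢₁,¢₂,B} ∪ {c₀,…,c_{n+1}}. -/
inductive Ltr (n : ℕ) : Type where
  | a1 : Ltr n
  | a2 : Ltr n
  | a3 : Ltr n
  | b1 : Ltr n
  | b2 : Ltr n
  | b3 : Ltr n
  | cent1 : Ltr n
  | cent2 : Ltr n
  | B : Ltr n
  | c : Fin (n + 2) → Ltr n

/-- The homomorphism h₁ : Γ* → Σ̂*, h₁(a) = a₁a₂a₃, h₁(b) = b₁b₂b₃. -/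
def h1 {n : ℕ} (w : List Γ) : List (Ltr n) :=
  w.flatMap fun g => match g with
    | Γ.a => [Ltr.a1, Ltr.a2, Ltr.a3]
    | Γ.b => [Ltr.b1, Ltr.b2, Ltr.b3]

/-- The homomorphism h₂ : Γ* → Σ̂*, h₂(a) = a₁a₂, h₂(b) = b₁b₂. -/
def h2 {n : ℕ} (w : List Γ) : List (Ltr n) :=
  w.flatMap fun g => match g with
    | Γ.a => [Ltr.a1, Ltr.a2]
    | Γ.b => [Ltr.b1, Ltr.b2]

/-- The homomorphism h₃ : Γ* → Σ̂*, h₃(a) = a₁, h₃(b) = b₁. -/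
def h3 {n : ℕ} (w : List Γ) : List (Ltr n) :=
  w.flatMap fun g => match g with
    | Γ.a => [Ltr.a1]
    | Γ.b => [Ltr.b1]

/-- One-step rewrite relation of a string rewriting system `R`
(a set of rules `(l, r)`): `u →_R v` iff `u = x l y` and `v = x r y`. -/
def OneStep {α : Type*} (R : Set (List α × List α)) (u v : List α) : Prop :=
  ∃ x y l r : List α, (l, r) ∈ R ∧ u = x ++ l ++ y ∧ v = x ++ r ++ y

/-- `u →*_R v`: reflexive-transitive closure of the one-step rewrite relation. -/
def RewStar {α : Type*} (R : Set (List α × List α)) : List α → List α → Prop :=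
  Relation.ReflTransGen (OneStep R)

/-- `u ↔*_R v`: the Thue congruence, i.e. the reflexive-transitive-symmetric
closure of the one-step rewrite relation. -/
def ThueCong {α : Type*} (R : Set (List α × List α)) : List α → List α → Prop :=
  Relation.EqvGen (OneStep R)

/-- The rules of the string rewriting system `S` constructed from the GPCP
instance with dominoes `(x i, y i)` for `i = 0, …, n+1`. -/
inductive SRule (n : ℕ) (x y : Fin (n + 2) → List Γ) :
    List (Ltr n) → List (Ltr n) → Prop where
  /- Class D rules -/
  | D1 (g : Γ) : SRule n x y ([Ltr.cent1] ++ h1 [g]) ([Ltr.cent1] ++ h3 [g])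
  | D2 (g : Γ) : SRule n x y ([Ltr.cent2] ++ h1 [g]) ([Ltr.cent2] ++ h2 [g])
  | D3 (g g' : Γ) : SRule n x y (h2 [g] ++ h1 [g']) (h2 [g] ++ h2 [g'])
  | D4 (g g' : Γ) : SRule n x y (h3 [g] ++ h1 [g']) (h3 [g] ++ h3 [g'])
  /- Class I rules -/
  | I1 : SRule n x y ([Ltr.cent1] ++ h3 (x 0) ++ [Ltr.B, Ltr.c 0]) []
  | I2 : SRule n x y ([Ltr.cent2] ++ h2 (y 0) ++ [Ltr.c 0]) []
  /- Class II rules -/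
  | II1 (i : Fin (n + 2)) (hi : 1 ≤ (i : ℕ)) (hn : (i : ℕ) ≤ n) :
      SRule n x y (h3 (x i) ++ [Ltr.B, Ltr.c i]) []
  | II2 (i : Fin (n + 2)) (hi : 1 ≤ (i : ℕ)) (hn : (i : ℕ) ≤ n) :
      SRule n x y (h2 (y i) ++ [Ltr.c i, Ltr.B]) []
  /- Class III rules -/
  | III1 : SRule n x y (h3 (x (Fin.last (n + 1))) ++ [Ltr.c (Fin.last (n + 1))]) []
  | III2 : SRule n x y (h2 (y (Fin.last (n + 1))) ++ [Ltr.c (Fin.last (n + 1)), Ltr.B]) []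

/-- The string rewriting system `S` as a set of rules. -/
def SSys (n : ℕ) (x y : Fin (n + 2) → List Γ) : Set (List (Ltr n) × List (Ltr n)) :=
  {p | SRule n x y p.1 p.2}

/-- The GPCP instance `(x i, y i)_{i = 0,…,n+1}` (with start domino index `0`,
end domino index `n+1` and intermediate dominoes `1,…,n`) has a solution:
a sequence of indices `i₁, …, i_k ∈ {1, …, n}` with
`x₀ x_{i₁} ⋯ x_{i_k} x_{n+1} = y₀ y_{i₁} ⋯ y_{i_k} y_{n+1}`. -/
def GPCPSolvable (n : ℕ) (x y : Fin (n + 2) → List Γ) : Prop :=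
  ∃ L : List (Fin (n + 2)), (∀ i ∈ L, 1 ≤ (i : ℕ) ∧ (i : ℕ) ≤ n) ∧
    x 0 ++ L.flatMap x ++ x (Fin.last (n + 1)) =
      y 0 ++ L.flatMap y ++ y (Fin.last (n + 1))

theorem RewStar.context {α : Type*} {R : Set (List α × List α)} {u v : List α}
    (h : RewStar R u v) (p q : List α) : RewStar R (p ++ u ++ q) (p ++ v ++ q) := by
  refine Relation.ReflTransGen.lift (fun t => p ++ t ++ q) ?_ _ _ h
  rintro _ _ ⟨s, t, l, r, hlr, rfl, rfl⟩
  exact ⟨p ++ s, t ++ q, l, r, hlr, by simp, by simp⟩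

theorem RewStar.of_mem {α : Type*} {R : Set (List α × List α)} {l r : List α}
    (h : (l, r) ∈ R) : RewStar R l r :=
  Relation.ReflTransGen.single ⟨[], [], l, r, h, by simp, by simp⟩

theorem RewStar.thueCong {α : Type*} {R : Set (List α × List α)} {u v : List α}
    (h : RewStar R u v) : ThueCong R u v := by
  induction h with
  | refl => exact .refl _
  | tail _ hs ih => exact .trans _ _ _ ih (.rel _ _ hs)

/-- If a rewriting system can replace `f g` by `h g` behind the prefix `p`, and behind any
block `h g'`, then it can replace a whole product of `f`-blocks behind `p`. -/
theorem RewStar.sweep {α β : Type*} {R : Set (List α × List α)} {f h : β → List α}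
    (hstep : ∀ g g', RewStar R (h g ++ f g') (h g ++ h g')) (w : List β) (p : List α)
    (hp : ∀ g, RewStar R (p ++ f g) (p ++ h g)) :
    RewStar R (p ++ w.flatMap f) (p ++ w.flatMap h) := by
  induction w generalizing p with
  | nil => exact .refl
  | cons g w ih =>
    have h₁ := (hp g).context [] (w.flatMap f)
    have h₂ := (ih (h g) (hstep g)).context p []
    simp only [List.nil_append, List.append_nil, List.append_assoc, List.flatMap_cons]
      at h₁ h₂ ⊢
    exact h₁.trans h₂

/-- Matching bracket blocks `f i … g i` cancel from the inside out. -/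
theorem RewStar.cancel_nested {α β : Type*} {R : Set (List α × List α)} {f g : β → List α}
    (L : List β) (h : ∀ i ∈ L, RewStar R (f i ++ g i) []) :
    RewStar R (L.flatMap f ++ L.reverse.flatMap g) [] := by
  induction L with
  | nil => exact .refl
  | cons i L ih =>
    have h₁ := (ih fun j hj => h j (List.mem_cons_of_mem _ hj)).context (f i) (g i)
    have h₂ := h i List.mem_cons_self
    simp only [List.append_nil, List.append_assoc, List.flatMap_cons, List.reverse_cons,
      List.flatMap_append, List.flatMap_nil] at h₁ h₂ ⊢
    exact h₁.trans h₂

/-- A separator in front of a product of blocks `s ++ f i` can be moved inside the blocks. -/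
theorem flatMap_append_separator {α β : Type*} (s : List α) (f : β → List α) (L : List β) :
    L.flatMap (fun i => s ++ f i) ++ s = s ++ L.flatMap (fun i => f i ++ s) := by
  induction L with
  | nil => simp
  | cons i L ih => simp [ih]

theorem h2_append {n : ℕ} (u v : List Γ) : (h2 (u ++ v) : List (Ltr n)) = h2 u ++ h2 v :=
  List.flatMap_append

theorem h3_append {n : ℕ} (u v : List Γ) : (h3 (u ++ v) : List (Ltr n)) = h3 u ++ h3 v :=
  List.flatMap_append

theorem h2_flatMap {n : ℕ} {β : Type*} (z : β → List Γ) (L : List β) :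
    (h2 (L.flatMap z) : List (Ltr n)) = L.flatMap fun i => h2 (z i) :=
  List.flatMap_assoc

theorem h3_flatMap {n : ℕ} {β : Type*} (z : β → List Γ) (L : List β) :
    (h3 (L.flatMap z) : List (Ltr n)) = L.flatMap fun i => h3 (z i) :=
  List.flatMap_assoc

section

variable {n : ℕ} {x y : Fin (n + 2) → List Γ}

theorem SRule.rewStar {l r : List (Ltr n)} (h : SRule n x y l r) :
    RewStar (SSys n x y) l r :=
  .of_mem h

theorem rewStar_cent1_h1 (w : List Γ) :
    RewStar (SSys n x y) ([Ltr.cent1] ++ h1 w) ([Ltr.cent1] ++ h3 w) := by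
  refine RewStar.sweep (fun g g' => ?_) w _ fun g => ?_
  · simpa [h1, h3] using (SRule.D4 g g' : SRule n x y _ _).rewStar
  · simpa [h1, h3] using (SRule.D1 g : SRule n x y _ _).rewStar

theorem rewStar_cent2_h1 (w : List Γ) :
    RewStar (SSys n x y) ([Ltr.cent2] ++ h1 w) ([Ltr.cent2] ++ h2 w) := by
  refine RewStar.sweep (fun g g' => ?_) w _ fun g => ?_
  · simpa [h1, h2] using (SRule.D3 g g' : SRule n x y _ _).rewStar
  · simpa [h1, h2] using (SRule.D2 g : SRule n x y _ _).rewStar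

theorem rewStar_cent1_solution (L : List (Fin (n + 2)))
    (hL : ∀ i ∈ L, 1 ≤ (i : ℕ) ∧ (i : ℕ) ≤ n) :
    RewStar (SSys n x y)
      (Ltr.cent1 :: (h1 (x 0 ++ L.flatMap x ++ x (Fin.last (n + 1))) ++
        [Ltr.c (Fin.last (n + 1))] ++
        L.reverse.flatMap (fun j => [Ltr.B, Ltr.c j]) ++ [Ltr.B, Ltr.c 0])) [] := by
  set V := L.reverse.flatMap (fun j => [(Ltr.B : Ltr n), Ltr.c j])
  have h₁ := (rewStar_cent1_h1 (x := x) (y := y)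
    (x 0 ++ L.flatMap x ++ x (Fin.last (n + 1)))).context []
    ([Ltr.c (Fin.last (n + 1))] ++ V ++ [Ltr.B, Ltr.c 0])
  have h₂ := (SRule.III1 : SRule n x y _ _).rewStar.context
    ([Ltr.cent1] ++ h3 (x 0) ++ h3 (L.flatMap x)) (V ++ [Ltr.B, Ltr.c 0])
  have h₃ := (RewStar.cancel_nested (R := SSys n x y) (f := fun i => h3 (x i)) L
    fun i hi => (SRule.II1 i (hL i hi).1 (hL i hi).2).rewStar).context
    ([Ltr.cent1] ++ h3 (x 0)) [Ltr.B, Ltr.c 0]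
  have h₄ := (SRule.I1 : SRule n x y _ _).rewStar
  simp only [← h3_flatMap, h3_append, List.append_assoc, List.cons_append, List.nil_append]
    at h₁ h₂ h₃ h₄ ⊢
  exact ((h₁.trans h₂).trans h₃).trans h₄

theorem rewStar_cent2_solution (L : List (Fin (n + 2)))
    (hL : ∀ i ∈ L, 1 ≤ (i : ℕ) ∧ (i : ℕ) ≤ n) :
    RewStar (SSys n x y)
      (Ltr.cent2 :: (h1 (y 0 ++ L.flatMap y ++ y (Fin.last (n + 1))) ++
        [Ltr.c (Fin.last (n + 1))] ++
        L.reverse.flatMap (fun j => [Ltr.B, Ltr.c j]) ++ [Ltr.B, Ltr.c 0])) [] := by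
  have hsep : L.reverse.flatMap (fun j => [(Ltr.B : Ltr n), Ltr.c j]) ++ [Ltr.B, Ltr.c 0] =
      [Ltr.B] ++ L.reverse.flatMap (fun j => [Ltr.c j, Ltr.B]) ++ [Ltr.c 0] := by
    simpa using congrArg (· ++ [Ltr.c 0])
      (flatMap_append_separator [(Ltr.B : Ltr n)] (fun j => [Ltr.c j]) L.reverse)
  rw [List.append_assoc _ (L.reverse.flatMap _), hsep]
  set V := L.reverse.flatMap (fun j => [Ltr.c j, (Ltr.B : Ltr n)])
  have h₁ := (rewStar_cent2_h1 (x := x) (y := y)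
    (y 0 ++ L.flatMap y ++ y (Fin.last (n + 1)))).context []
    ([Ltr.c (Fin.last (n + 1))] ++ [Ltr.B] ++ V ++ [Ltr.c 0])
  have h₂ := (SRule.III2 : SRule n x y _ _).rewStar.context
    ([Ltr.cent2] ++ h2 (y 0) ++ h2 (L.flatMap y)) (V ++ [Ltr.c 0])
  have h₃ := (RewStar.cancel_nested (R := SSys n x y) (f := fun i => h2 (y i)) L
    fun i hi => (SRule.II2 i (hL i hi).1 (hL i hi).2).rewStar).context
    ([Ltr.cent2] ++ h2 (y 0)) [Ltr.c 0]
  have h₄ := (SRule.I2 : SRule n x y _ _).rewStar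
  simp only [← h2_flatMap, h2_append, List.append_assoc, List.cons_append, List.nil_append]
    at h₁ h₂ h₃ h₄ ⊢
  exact ((h₁.trans h₂).trans h₃).trans h₄

end

/-- If `i₁, …, i_k` is a solution of the GPCP instance with matched string `w`,
then for `W = h₁(w) c_{n+1} B c_{i_k} B ⋯ B c_{i₁} B c₀` we have
`¢₁ W →*_S λ` and `¢₂ W →*_S λ`; in particular `¢₁ W ↔*_S ¢₂ W`. -/
theorem gpcp_solution_gives_ct_solution (n : ℕ) (x y : Fin (n + 2) → List Γ)
    (hx : ∀ i, x i ≠ []) (hy : ∀ i, y i ≠ [])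
    (L : List (Fin (n + 2))) (hL : ∀ i ∈ L, 1 ≤ (i : ℕ) ∧ (i : ℕ) ≤ n)
    (w : List Γ)
    (hwx : w = x 0 ++ L.flatMap x ++ x (Fin.last (n + 1)))
    (hwy : w = y 0 ++ L.flatMap y ++ y (Fin.last (n + 1)))
    (W : List (Ltr n))
    (hW : W = h1 w ++ [Ltr.c (Fin.last (n + 1))] ++
      L.reverse.flatMap (fun j => [Ltr.B, Ltr.c j]) ++ [Ltr.B, Ltr.c 0]) :
    RewStar (SSys n x y) (Ltr.cent1 :: W) [] ∧
    RewStar (SSys n x y) (Ltr.cent2 :: W) [] ∧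
    ThueCong (SSys n x y) (Ltr.cent1 :: W) (Ltr.cent2 :: W) := by
  have hc₁ : RewStar (SSys n x y) (Ltr.cent1 :: W) [] := by
    rw [hW, hwx]
    exact rewStar_cent1_solution L hL
  have hc₂ : RewStar (SSys n x y) (Ltr.cent2 :: W) [] := by
    rw [hW, hwy]
    exact rewStar_cent2_solution L hL
  exact ⟨hc₁, hc₂, .trans _ _ _ hc₁.thueCong (.symm _ _ hc₂.thueCong)⟩
end

section
/- Let S be the string rewriting system constructed from a given GPCP instance as described. Then every string u ∈ Σ̂* has a unique normal form: there exists a unique string v such that u →*_S v and v is irreducible with respect to S (no rule of S applies to v). -/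
section Abstract

variable {α : Type*} {R : Set (List α × List α)}

/-- A system is non-overlapping if two occurrences of left-hand sides in a string either
are disjoint or coincide, in which case the rules coincide as well. -/
def NonOverlapping (R : Set (List α × List α)) : Prop :=
  ∀ ⦃t s l' r r' y y' : List α⦄, (t ++ s, r) ∈ R → (l', r') ∈ R → s ≠ [] →
    l' ++ y' = s ++ y → t = [] ∧ l' = s ∧ r = r'

theorem OneStep.intro {l r : List α} (h : (l, r) ∈ R) (x y : List α) :
    OneStep R (x ++ l ++ y) (x ++ r ++ y) :=
  ⟨x, y, l, r, h, rfl, rfl⟩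

theorem NonOverlapping.diamond_of_append_eq (hR : NonOverlapping R) {l r l' r' x t y y' : List α}
    (hl : (l, r) ∈ R) (hl' : (l', r') ∈ R) (h : l ++ y = t ++ (l' ++ y')) :
    x ++ r ++ y = x ++ t ++ r' ++ y' ∨
      ∃ d, OneStep R (x ++ r ++ y) d ∧ OneStep R (x ++ t ++ r' ++ y') d := by
  have disjoint : ∀ s, t = l ++ s → y = s ++ (l' ++ y') →
      ∃ d, OneStep R (x ++ r ++ y) d ∧ OneStep R (x ++ t ++ r' ++ y') d := by
    rintro s rfl rfl
    refine ⟨x ++ r ++ s ++ r' ++ y', ?_, ?_⟩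
    · simpa using OneStep.intro hl' (x ++ r ++ s) y'
    · simpa using OneStep.intro hl x (s ++ r' ++ y')
  rcases List.append_eq_append_iff.1 h with ⟨s, ht, hy⟩ | ⟨s, hs, hy⟩
  · exact Or.inr (disjoint s ht hy)
  · rcases eq_or_ne s [] with rfl | hne
    · exact Or.inr (disjoint [] (by simpa using hs.symm) (by simpa using hy.symm))
    · subst hs
      obtain ⟨rfl, rfl, rfl⟩ := hR hl hl' hne hy
      left
      simpa using hy.symm

theorem NonOverlapping.diamond (hR : NonOverlapping R) {u v w : List α}
    (hv : OneStep R u v) (hw : OneStep R u w) :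
    v = w ∨ ∃ d, OneStep R v d ∧ OneStep R w d := by
  obtain ⟨x, y, l, r, hl, rfl, rfl⟩ := hv
  obtain ⟨x', y', l', r', hl', h, rfl⟩ := hw
  rw [List.append_assoc, List.append_assoc] at h
  rcases List.append_eq_append_iff.1 h with ⟨t, rfl, ht⟩ | ⟨t, rfl, ht⟩
  · exact hR.diamond_of_append_eq hl hl' ht
  · exact (hR.diamond_of_append_eq (x := x') hl' hl ht).imp Eq.symm
      fun ⟨d, h₁, h₂⟩ => ⟨d, h₂, h₁⟩

theorem NonOverlapping.confluent (hR : NonOverlapping R) {u v w : List α}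
    (hv : RewStar R u v) (hw : RewStar R u w) :
    ∃ d, RewStar R v d ∧ RewStar R w d := by
  refine Relation.church_rosser (fun a b c hb hc => ?_) hv hw
  rcases hR.diamond hb hc with rfl | ⟨d, h₁, h₂⟩
  · exact ⟨b, .refl, .refl⟩
  · exact ⟨d, .single h₁, .single h₂⟩

theorem RewStar.eq_of_irreducible {u v : List α} (h : RewStar R u v)
    (hu : ¬ ∃ u', OneStep R u u') : v = u := by
  rcases Relation.ReflTransGen.cases_head h with rfl | ⟨w, hw, -⟩
  · rfl
  · exact absurd ⟨w, hw⟩ hu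

theorem OneStep.length_lt (hR : ∀ p ∈ R, p.2.length < p.1.length) {u v : List α}
    (h : OneStep R u v) : v.length < u.length := by
  obtain ⟨x, y, l, r, hl, rfl, rfl⟩ := h
  have : r.length < l.length := hR _ hl
  simp only [List.length_append]
  omega

theorem exists_normalForm (hR : ∀ p ∈ R, p.2.length < p.1.length) (u : List α) :
    ∃ v, RewStar R u v ∧ ¬ ∃ v', OneStep R v v' := by
  induction hk : u.length using Nat.strong_induction_on generalizing u with
  | _ k ih =>
    by_cases hu : ∃ u', OneStep R u u'
    · obtain ⟨u', hu'⟩ := hu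
      obtain ⟨v, hv, hirr⟩ := ih _ (hk ▸ hu'.length_lt hR) u' rfl
      exact ⟨v, .head hu' hv, hirr⟩
    · exact ⟨u, .refl, hu⟩

theorem NonOverlapping.existsUnique_normalForm (hR : NonOverlapping R)
    (hlen : ∀ p ∈ R, p.2.length < p.1.length) (u : List α) :
    ∃! v, RewStar R u v ∧ ¬ ∃ v', OneStep R v v' := by
  obtain ⟨v, hv, hirr⟩ := exists_normalForm hlen u
  refine ⟨v, ⟨hv, hirr⟩, ?_⟩
  rintro w ⟨hw, hirr'⟩
  obtain ⟨d, hvd, hwd⟩ := hR.confluent hv hw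
  rw [← RewStar.eq_of_irreducible hvd hirr, ← RewStar.eq_of_irreducible hwd hirr']

end Abstract

theorem append_eq_append_of_first_mismatch {α : Type*} {P : α → Prop} {p q k k' y y' : List α}
    (hp : ∀ a ∈ p, ¬ P a) (hq : ∀ a ∈ q, ¬ P a) (hk : ∃ a ∈ k.head?, P a)
    (hk' : ∃ a ∈ k'.head?, P a) (h : p ++ (k ++ y) = q ++ (k' ++ y')) :
    p = q ∧ k ++ y = k' ++ y' := by
  induction p generalizing q with
  | nil =>
    cases q with
    | nil => exact ⟨rfl, h⟩
    | cons b q => cases k <;> simp_all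
  | cons a p ih =>
    cases q with
    | nil => cases k' <;> simp_all
    | cons b q =>
      simp only [List.cons_append, List.cons.injEq] at h
      obtain ⟨rfl, h⟩ := h
      simp only [List.mem_cons, forall_eq_or_imp] at hp hq
      simpa using ih hp.2 hq.2 h

section Markers

variable {n : ℕ}

/-- The letters that close a left-hand side of `S`. -/
def Ltr.IsMarker : Ltr n → Prop
  | .a3 | .b3 | .B | .c _ => True
  | _ => False

/-- The letters `a₁` and `b₁`. -/
def Ltr.IsFirst : Ltr n → Prop
  | .a1 | .b1 => True
  | _ => False

/-- The letters `a₂` and `b₂`. -/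
def Ltr.IsSecond : Ltr n → Prop
  | .a2 | .b2 => True
  | _ => False

/-- The third letter of `h₁(g)`. -/
def third : Γ → Ltr n
  | .a => .a3
  | .b => .b3

theorem not_isMarker_of_mem_h2 {w : List Γ} : ∀ a ∈ (h2 w : List (Ltr n)), ¬ a.IsMarker := by
  intro a ha
  simp only [h2, List.mem_flatMap] at ha
  obtain ⟨g, -, hg⟩ := ha
  cases g <;> simp at hg <;> rcases hg with rfl | rfl <;> simp [Ltr.IsMarker]

theorem not_isMarker_of_mem_h3 {w : List Γ} : ∀ a ∈ (h3 w : List (Ltr n)), ¬ a.IsMarker := by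
  intro a ha
  simp only [h3, List.mem_flatMap] at ha
  obtain ⟨g, -, hg⟩ := ha
  cases g <;> simp at hg <;> subst hg <;> simp [Ltr.IsMarker]

theorem h2_eq_append {w : List Γ} (hw : w ≠ []) :
    ∃ (p : List (Ltr n)) (a : Ltr n), a.IsSecond ∧ h2 w = p ++ [a] := by
  obtain ⟨v, g, rfl⟩ := List.eq_nil_or_concat' w |>.resolve_left hw
  cases g
  · exact ⟨h2 v ++ [.a1], .a2, trivial, by simp [h2]⟩
  · exact ⟨h2 v ++ [.b1], .b2, trivial, by simp [h2]⟩

theorem h3_eq_append {w : List Γ} (hw : w ≠ []) :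
    ∃ (p : List (Ltr n)) (a : Ltr n), a.IsFirst ∧ h3 w = p ++ [a] := by
  obtain ⟨v, g, rfl⟩ := List.eq_nil_or_concat' w |>.resolve_left hw
  cases g
  · exact ⟨h3 v, .a1, trivial, by simp [h3]⟩
  · exact ⟨h3 v, .b1, trivial, by simp [h3]⟩

theorem h1_singleton (g : Γ) : (h1 [g] : List (Ltr n)) = h2 [g] ++ [third g] := by
  cases g <;> rfl

/-- `ClassD p k r` : there is a Class D rule `p ++ k → r` with closing letter `k`. -/
inductive ClassD : List (Ltr n) → List (Ltr n) → List (Ltr n) → Prop where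
  | D1 (g : Γ) : ClassD ([.cent1] ++ h2 [g]) [third g] ([.cent1] ++ h3 [g])
  | D2 (g : Γ) : ClassD ([.cent2] ++ h2 [g]) [third g] ([.cent2] ++ h2 [g])
  | D3 (g d : Γ) : ClassD (h2 [g] ++ h2 [d]) [third d] (h2 [g] ++ h2 [d])
  | D4 (g d : Γ) : ClassD (h3 [g] ++ h2 [d]) [third d] (h3 [g] ++ h3 [d])

/-- `Erasing x y p k` : there is an erasing rule `p ++ k → λ` with closing string `k`. -/
inductive Erasing (x y : Fin (n + 2) → List Γ) : List (Ltr n) → List (Ltr n) → Prop where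
  | I1 : Erasing x y ([.cent1] ++ h3 (x 0)) [.B, .c 0]
  | I2 : Erasing x y ([.cent2] ++ h2 (y 0)) [.c 0]
  | II1 (i : Fin (n + 2)) (hi : 1 ≤ (i : ℕ)) (hn : (i : ℕ) ≤ n) :
      Erasing x y (h3 (x i)) [.B, .c i]
  | II2 (i : Fin (n + 2)) (hi : 1 ≤ (i : ℕ)) (hn : (i : ℕ) ≤ n) :
      Erasing x y (h2 (y i)) [.c i, .B]
  | III1 : Erasing x y (h3 (x (Fin.last (n + 1)))) [.c (Fin.last (n + 1))]
  | III2 : Erasing x y (h2 (y (Fin.last (n + 1)))) [.c (Fin.last (n + 1)), .B]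

variable {x y : Fin (n + 2) → List Γ}

theorem SRule.split {l r : List (Ltr n)} (h : SRule n x y l r) :
    ∃ p k, l = p ++ k ∧ (ClassD p k r ∨ Erasing x y p k ∧ r = []) := by
  cases h with
  | D1 g => exact ⟨_, _, by simp [h1_singleton], .inl (.D1 g)⟩
  | D2 g => exact ⟨_, _, by simp [h1_singleton], .inl (.D2 g)⟩
  | D3 g d => exact ⟨_, _, by simp [h1_singleton], .inl (.D3 g d)⟩
  | D4 g d => exact ⟨_, _, by simp [h1_singleton], .inl (.D4 g d)⟩
  | I1 => exact ⟨_, _, rfl, .inr ⟨.I1, rfl⟩⟩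
  | I2 => exact ⟨_, _, rfl, .inr ⟨.I2, rfl⟩⟩
  | II1 i hi hn => exact ⟨_, _, rfl, .inr ⟨.II1 i hi hn, rfl⟩⟩
  | II2 i hi hn => exact ⟨_, _, rfl, .inr ⟨.II2 i hi hn, rfl⟩⟩
  | III1 => exact ⟨_, _, rfl, .inr ⟨.III1, rfl⟩⟩
  | III2 => exact ⟨_, _, rfl, .inr ⟨.III2, rfl⟩⟩

theorem ClassD.shape {p k r : List (Ltr n)} (h : ClassD p k r) :
    p ≠ [] ∧ (∀ a ∈ p, ¬ a.IsMarker) ∧ (∃ a ∈ k.head?, a.IsMarker) ∧ (∀ a ∈ k, a.IsMarker) := by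
  cases h <;> rename_i g <;> cases g <;> (try (rename_i d; cases d)) <;>
    simp [h2, h3, third, Ltr.IsMarker]

theorem Erasing.shape (hx : ∀ i, x i ≠ []) (hy : ∀ i, y i ≠ []) {p k : List (Ltr n)}
    (h : Erasing x y p k) :
    p ≠ [] ∧ (∀ a ∈ p, ¬ a.IsMarker) ∧ (∃ a ∈ k.head?, a.IsMarker) ∧ (∀ a ∈ k, a.IsMarker) := by
  have hx' : ∀ i, (h3 (x i) : List (Ltr n)) ≠ [] := fun i => by
    obtain ⟨p, a, -, h⟩ := h3_eq_append (n := n) (hx i); simp [h]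
  have hy' : ∀ i, (h2 (y i) : List (Ltr n)) ≠ [] := fun i => by
    obtain ⟨p, a, -, h⟩ := h2_eq_append (n := n) (hy i); simp [h]
  have mx := fun i => not_isMarker_of_mem_h3 (n := n) (w := x i)
  have my := fun i => not_isMarker_of_mem_h2 (n := n) (w := y i)
  cases h <;> refine ⟨by simp [hx', hy'], ?_, ?_, ?_⟩ <;> simp [Ltr.IsMarker] <;>
    first | exact mx _ | exact my _

theorem ClassD.length_bounds {p k r : List (Ltr n)} (h : ClassD p k r) :
    3 ≤ p.length ∧ p.length ≤ 4 := by
  cases h <;> rename_i g <;> cases g <;> (try (rename_i d; cases d)) <;> simp [h2, h3]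

theorem ClassD.eq_of_suffix {p k r t q k' r' z z' : List (Ltr n)} (h : ClassD p k r)
    (h' : ClassD q k' r') (hp : p = t ++ q) (hk : k ++ z = k' ++ z') :
    t = [] ∧ k = k' ∧ r = r' := by
  have ht : t.length ≤ 1 := by
    have h₁ := h.length_bounds.2
    have h₂ := h'.length_bounds.1
    simp only [hp, List.length_append] at h₁
    omega
  rcases t with _ | ⟨a, _ | ⟨b, t⟩⟩
  case cons.cons => simp at ht
  all_goals
    cases h <;> rename_i g <;> cases g <;> (try (rename_i g; cases g)) <;>
      cases h' <;> rename_i g <;> cases g <;> (try (rename_i g; cases g)) <;>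
      simp [h2, h3, third] at hp hk ⊢

theorem ClassD.not_erasing {p k r q k' z z' : List (Ltr n)} (h : ClassD p k r)
    (h' : Erasing x y q k') : k ++ z ≠ k' ++ z' := by
  cases h <;> rename_i g <;> cases g <;> cases h' <;> simp [third]

theorem h3_ne_append_h2 {v w : List Γ} (hv : v ≠ []) (hw : w ≠ []) (s t : List (Ltr n)) :
    s ++ h3 v ≠ t ++ h2 w := by
  obtain ⟨p, a, ha, hp⟩ := h3_eq_append (n := n) hv
  obtain ⟨q, b, hb, hq⟩ := h2_eq_append (n := n) hw
  rw [hp, hq, ← List.append_assoc, ← List.append_assoc]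
  intro h
  obtain rfl := List.singleton_injective (List.append_inj_right' h rfl)
  cases a <;> simp_all [Ltr.IsFirst, Ltr.IsSecond]

theorem Erasing.eq_of_suffix (hx : ∀ i, x i ≠ []) (hy : ∀ i, y i ≠ [])
    {p k t q k' z z' : List (Ltr n)} (h : Erasing x y p k)
    (h' : Erasing x y q k') (hp : p = t ++ q) (hk : k ++ z = k' ++ z') :
    t = [] ∧ k = k' := by
  suffices p = q ∧ k = k' by
    obtain ⟨rfl, rfl⟩ := this
    exact ⟨by simpa using hp, rfl⟩
  cases h <;> cases h' <;>
    simp only [List.cons_append, List.nil_append, List.cons.injEq, Ltr.c.injEq, reduceCtorEq,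
      false_and, and_false, true_and] at hk
  case III1.III2 => exact absurd hp (h3_ne_append_h2 (hx _) (hy _) [] t)
  case III2.III1 => exact absurd hp.symm (h3_ne_append_h2 (hx _) (hy _) t [])
  all_goals first
    | exact ⟨rfl, rfl⟩
    | obtain ⟨rfl, -⟩ := hk; exact ⟨rfl, rfl⟩
    | (simp only [Fin.ext_iff, Fin.val_zero, Fin.val_last] at hk; omega)

end Markers

theorem SSys_nonOverlapping {n : ℕ} {x y : Fin (n + 2) → List Γ}
    (hx : ∀ i, x i ≠ []) (hy : ∀ i, y i ≠ []) : NonOverlapping (SSys n x y) := by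
  intro t s l' r r' z z' h h' hs he
  obtain ⟨p, k, hl, hp⟩ := SRule.split h
  obtain ⟨q, k', rfl, hq⟩ := SRule.split h'
  obtain ⟨-, p_plain, k_head, k_marker⟩ := hp.elim (·.shape) (·.1.shape hx hy)
  obtain ⟨q_ne, q_plain, k'_head, -⟩ := hq.elim (·.shape) (·.1.shape hx hy)
  simp only at hl hp hq
  rw [List.append_assoc] at he
  rcases List.append_eq_append_iff.1 hl with ⟨p', rfl, rfl⟩ | ⟨k₁, rfl, rfl⟩
  · rw [List.append_assoc] at he
    obtain ⟨rfl, hk⟩ := append_eq_append_of_first_mismatch q_plain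
      (fun a ha => p_plain a (by simp [ha])) k'_head k_head he
    suffices t = [] ∧ k = k' ∧ r = r' by
      obtain ⟨rfl, rfl, rfl⟩ := this; simp
    rcases hp with hp | ⟨hp, rfl⟩ <;> rcases hq with hq | ⟨hq, rfl⟩
    · exact hp.eq_of_suffix hq rfl hk.symm
    · exact absurd hk.symm (hp.not_erasing hq)
    · exact absurd hk (hq.not_erasing hp)
    · obtain ⟨h₁, h₂⟩ := hp.eq_of_suffix hx hy hq rfl hk.symm
      exact ⟨h₁, h₂, rfl⟩
  · exfalso
    cases q with
    | nil => exact q_ne rfl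
    | cons a q =>
      cases s with
      | nil => exact hs rfl
      | cons b s =>
        simp only [List.cons_append, List.cons.injEq] at he
        exact q_plain a (by simp) (he.1 ▸ k_marker b (by simp))

theorem SRule.length_lt {n : ℕ} {x y : Fin (n + 2) → List Γ} {l r : List (Ltr n)}
    (h : SRule n x y l r) : r.length < l.length := by
  cases h <;> (try (rename_i g; cases g)) <;> (try (rename_i d; cases d)) <;>
    simp [h1, h2, h3]

/-- Every string `u ∈ Σ̂*` has a unique `S`-normal form: a unique `v` with
`u →*_S v` and `v` irreducible. -/
theorem S_unique_normal_forms (n : ℕ) (x y : Fin (n + 2) → List Γ)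
    (hx : ∀ i, x i ≠ []) (hy : ∀ i, y i ≠ []) :
    ∀ u : List (Ltr n), ∃! v : List (Ltr n),
      RewStar (SSys n x y) u v ∧ ¬ ∃ v' : List (Ltr n), OneStep (SSys n x y) v v' :=
  (SSys_nonOverlapping hx hy).existsUnique_normalForm fun _ h => SRule.length_lt h
end
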